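/- arXiv:1903.04306 — 2 statements merged into one kernel-verified Lean document; each statement's English description precedes it below -/
import Mathlib

section
/- Conditional likelihood approximation lemma (Lemma 4 / 'lemmet1'). Fix any θ ∈ Θ and for each t ∈ {1,…,T} let ẑ^t = argmax_{z ∈ {1,…,Q}^n} log P_θ(X^t | Z^t = z). Then, almost surely, for every t ∈ {1,…,T}: | log P_θ(X^t | X^{1:t−1}) − log P_θ(X^t | Z^t = ẑ^t) | ≤ | log P_θ(Z^t = ẑ^t | X^{1:t−1}) |, where for t = 1 the conditioning on X^{1:0} is understood as no conditioning. -/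
open Finset Filter Asymptotics

namespace DynSBM

/-- Bernoulli weight: probability of observing `b` under a Bernoulli(`p`) law. -/
noncomputable def bern (p : ℝ) (b : Bool) : ℝ := if b then p else 1 - p

/-- A `Q × Q` row-stochastic matrix. -/
def IsStochastic {Q : ℕ} (A : Fin Q → Fin Q → ℝ) : Prop :=
  (∀ q l, 0 ≤ A q l) ∧ ∀ q, ∑ l, A q l = 1

/-- `α` is a stationary distribution of the transition matrix `Γ`. -/
def IsStationary {Q : ℕ} (Γ : Fin Q → Fin Q → ℝ) (α : Fin Q → ℝ) : Prop :=
  (∀ q, 0 ≤ α q) ∧ (∑ q, α q = 1) ∧ ∀ l, ∑ q, α q * Γ q l = α l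

/-- The stationary distribution of `Γ`, chosen by (classical) choice; under the model
assumptions it exists and is unique, and `statDist Γ` is then this distribution. -/
noncomputable def statDist {Q : ℕ} (Γ : Fin Q → Fin Q → ℝ) : Fin Q → ℝ :=
  Classical.epsilon (IsStationary Γ)

/-- Latent configurations: `z i t` is the class of node `i` at time `t`. -/
abbrev Config (n T Q : ℕ) := Fin n → Fin T → Fin Q

/-- Observations: `x t i j` is the edge indicator between nodes `i` and `j` at time `t`
(only the entries with `i < j` are used). -/
abbrev Obs (n T : ℕ) := Fin T → Fin n → Fin n → Bool

/-- Probability of a latent configuration: i.i.d. nodes, each a stationary Markov chain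
with transition matrix `Γ` and initial law `α`. -/
noncomputable def latentP {Q : ℕ} (n T : ℕ) (Γ : Fin Q → Fin Q → ℝ) (α : Fin Q → ℝ)
    (z : Config n T Q) : ℝ :=
  ∏ i : Fin n, ((if h : 0 < T then α (z i ⟨0, h⟩) else 1) *
    ∏ t : Fin T, if h : (t : ℕ) + 1 < T then Γ (z i t) (z i ⟨(t : ℕ) + 1, h⟩) else 1)

/-- Conditional probability of the observations given the latent configuration, with
(possibly time-varying) connectivity parameters `π`. -/
noncomputable def condP {Q : ℕ} (n T : ℕ) (π : Fin T → Fin Q → Fin Q → ℝ)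
    (z : Config n T Q) (x : Obs n T) : ℝ :=
  ∏ t : Fin T, ∏ i : Fin n, ∏ j : Fin n,
    if i < j then bern (π t (z i t) (z j t)) (x t i j) else 1

/-- Joint density of `(z, x)`. -/
noncomputable def jointP {Q : ℕ} (n T : ℕ) (Γ : Fin Q → Fin Q → ℝ) (α : Fin Q → ℝ)
    (π : Fin T → Fin Q → Fin Q → ℝ) (z : Config n T Q) (x : Obs n T) : ℝ :=
  latentP n T Γ α z * condP n T π z x

/-- Likelihood of the observations `x`. -/
noncomputable def lik {Q : ℕ} (n T : ℕ) (Γ : Fin Q → Fin Q → ℝ) (α : Fin Q → ℝ)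
    (π : Fin T → Fin Q → Fin Q → ℝ) (x : Obs n T) : ℝ :=
  ∑ z : Config n T Q, jointP n T Γ α π z x

/-- Probability of an event on `(Z^{1:T}, X^{1:T})` under the model. -/
noncomputable def Pr {Q : ℕ} (n T : ℕ) (Γ : Fin Q → Fin Q → ℝ) (α : Fin Q → ℝ)
    (π : Fin T → Fin Q → Fin Q → ℝ) (A : Set (Config n T Q × Obs n T)) : ℝ :=
  ∑ ω : Config n T Q × Obs n T, A.indicator (fun ω' => jointP n T Γ α π ω'.1 ω'.2) ω

/-- Conditional probability `P_θ(Z^{1:T} ∈ B | X^{1:T} = x)`. -/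
noncomputable def condZP {Q : ℕ} (n T : ℕ) (Γ : Fin Q → Fin Q → ℝ) (α : Fin Q → ℝ)
    (π : Fin T → Fin Q → Fin Q → ℝ) (B : Set (Config n T Q)) (x : Obs n T) : ℝ :=
  (∑ z : Config n T Q, B.indicator (fun z' => jointP n T Γ α π z' x) z) /
    lik n T Γ α π x

/-- A parameter `θ = (Γ, π)` of the dynamic SBM with constant connectivity. -/
structure Param (Q : ℕ) where
  Γ : Fin Q → Fin Q → ℝ
  π : Fin Q → Fin Q → ℝ

/-- A parameter `θ = (Γ, π^{1:T})` of the dynamic SBM with time-varying connectivity. -/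
structure ParamT (Q T : ℕ) where
  Γ : Fin Q → Fin Q → ℝ
  π : Fin T → Fin Q → Fin Q → ℝ

/-- The parameter set `Θ` (assumptions (A1), (A2), (A3), `Γ` stochastic, `π` symmetric). -/
def memTheta {Q : ℕ} (δ ζ : ℝ) (θ : Param Q) : Prop :=
  (∀ q q', q ≠ q' → ∃ l, θ.π q l ≠ θ.π q' l) ∧
  (∀ q l, θ.Γ q l ∈ Set.Icc δ (1 - δ)) ∧
  (∀ q, ∑ l, θ.Γ q l = 1) ∧
  (∀ q l, θ.π q l ∈ Set.Icc ζ (1 - ζ)) ∧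
  (∀ q l, θ.π q l = θ.π l q)

/-- The parameter set `Θ^T` (assumptions (A1'), (A2), (A3'), (A4)). -/
def memThetaT {Q T : ℕ} (δ ζ : ℝ) (θ : ParamT Q T) : Prop :=
  (∀ t q q', q ≠ q' → ∃ l, θ.π t q l ≠ θ.π t q' l) ∧
  (∀ q l, θ.Γ q l ∈ Set.Icc δ (1 - δ)) ∧
  (∀ q, ∑ l, θ.Γ q l = 1) ∧
  (∀ t q l, θ.π t q l ∈ Set.Icc ζ (1 - ζ)) ∧
  (∀ t q l, θ.π t q l = θ.π t l q) ∧
  (∀ t t' q, θ.π t q q = θ.π t' q q) ∧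
  (∀ q q' t, q ≠ q' → θ.π t q q ≠ θ.π t q' q')

/-- Log-likelihood `ℓ(θ)` for constant connectivity. -/
noncomputable def loglik {Q : ℕ} (n T : ℕ) (θ : Param Q) (x : Obs n T) : ℝ :=
  Real.log (lik n T θ.Γ (statDist θ.Γ) (fun _ => θ.π) x)

/-- Log-likelihood `ℓ(θ)` for time-varying connectivity. -/
noncomputable def loglikT {Q T : ℕ} (n : ℕ) (θ : ParamT Q T) (x : Obs n T) : ℝ :=
  Real.log (lik n T θ.Γ (statDist θ.Γ) θ.π x)

/-- Normalized log-likelihood `M_{n,T}(Γ, π)`. -/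
noncomputable def Mnt {Q : ℕ} (n T : ℕ) (θ : Param Q) (x : Obs n T) : ℝ :=
  2 / ((n : ℝ) * ((n : ℝ) - 1) * (T : ℝ)) * loglik n T θ x

/-- `𝕄(π, A)`. -/
noncomputable def Mcontrast {Q : ℕ} (αstar : Fin Q → ℝ) (πstar π : Fin Q → Fin Q → ℝ)
    (A : Fin Q → Fin Q → ℝ) : ℝ :=
  ∑ q, ∑ l, αstar q * αstar l * ∑ q', ∑ l', A q q' * A l l' *
    (πstar q l * Real.log (π q' l') + (1 - πstar q l) * Real.log (1 - π q' l'))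

/-- `𝕄(π) = sup_A 𝕄(π, A)`, supremum over `Q × Q` stochastic matrices. -/
noncomputable def Mlim {Q : ℕ} (αstar : Fin Q → ℝ) (πstar π : Fin Q → Fin Q → ℝ) : ℝ :=
  sSup {m : ℝ | ∃ A, IsStochastic A ∧ m = Mcontrast αstar πstar π A}

/-- `‖π - π'‖_∞`. -/
noncomputable def dinf {Q : ℕ} (π π' : Fin Q → Fin Q → ℝ) : ℝ :=
  ⨆ q, ⨆ l, |π q l - π' q l|

/-- `‖π^{1:T} - π'^{1:T}‖_∞`. -/
noncomputable def dinfT {Q T : ℕ} (π π' : Fin T → Fin Q → Fin Q → ℝ) : ℝ :=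
  ⨆ t, ⨆ q, ⨆ l, |π t q l - π' t q l|

/-- Relabelling of a matrix by a permutation of the classes. -/
def permMat {Q : ℕ} (σ : Equiv.Perm (Fin Q)) (π : Fin Q → Fin Q → ℝ) :
    Fin Q → Fin Q → ℝ := fun q l => π (σ q) (σ l)

/-- `min_{σ ∈ S_Q} ‖π_σ - π'‖_∞`. -/
noncomputable def minPermDist {Q : ℕ} (π π' : Fin Q → Fin Q → ℝ) : ℝ :=
  ⨅ σ : Equiv.Perm (Fin Q), dinf (permMat σ π) π'

/-- `min_{σ ∈ S_Q} ‖π^{1:T}_σ - π'^{1:T}‖_∞` (a single permutation for all times). -/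
noncomputable def minPermDistT {Q T : ℕ} (π π' : Fin T → Fin Q → Fin Q → ℝ) : ℝ :=
  ⨅ σ : Equiv.Perm (Fin Q), dinfT (fun t => permMat σ (π t)) π'

/-- The MLE fixed-point equation for the transition matrix (Lemma 1):
`Γ q l = Σ_{t<T-1} Σ_i P(Z_i^t = q, Z_i^{t+1} = l | X) / Σ_{t<T-1} Σ_i P(Z_i^t = q | X)`. -/
def FixedPointEq {Q : ℕ} (n T : ℕ) (Γ : Fin Q → Fin Q → ℝ) (α : Fin Q → ℝ)
    (π : Fin T → Fin Q → Fin Q → ℝ) (x : Obs n T) : Prop :=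
  ∀ q l : Fin Q, Γ q l =
    (∑ t : Fin T, if h : (t : ℕ) + 1 < T then
        ∑ i : Fin n, condZP n T Γ α π {z | z i t = q ∧ z i ⟨(t : ℕ) + 1, h⟩ = l} x
      else 0) /
    (∑ t : Fin T, if (t : ℕ) + 1 < T then
        ∑ i : Fin n, condZP n T Γ α π {z | z i t = q} x
      else 0)

/-- A variational parameter `χ = (τ, η)`. -/
structure VarParam (n T Q : ℕ) where
  τ : Fin n → Fin T → Fin Q → ℝ
  η : Fin n → Fin T → Fin Q → Fin Q → ℝ

/-- The variational parameters lie in `[0,1]`. -/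
def VarParam.valid {n T Q : ℕ} (χ : VarParam n T Q) : Prop :=
  (∀ i t q, χ.τ i t q ∈ Set.Icc (0 : ℝ) 1) ∧ ∀ i t q l, χ.η i t q l ∈ Set.Icc (0 : ℝ) 1

/-- The variational distribution `Q_χ` on latent configurations. -/
noncomputable def Qchi {n T Q : ℕ} (χ : VarParam n T Q) (z : Config n T Q) : ℝ :=
  ∏ i : Fin n, ((if h : 0 < T then χ.τ i ⟨0, h⟩ (z i ⟨0, h⟩) else 1) *
    ∏ t : Fin T, if h : (t : ℕ) + 1 < T then
      χ.η i t (z i t) (z i ⟨(t : ℕ) + 1, h⟩) / χ.τ i t (z i t) else 1)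

/-- The variational criterion `J(χ, θ) = E_{Q_χ}[log P_θ(X, Z)] + H(Q_χ)`. -/
noncomputable def Jfun {Q : ℕ} (n T : ℕ) (Γ : Fin Q → Fin Q → ℝ) (α : Fin Q → ℝ)
    (π : Fin T → Fin Q → Fin Q → ℝ) (x : Obs n T) (χ : VarParam n T Q) : ℝ :=
  (∑ z : Config n T Q, Qchi χ z * Real.log (jointP n T Γ α π z x)) -
    ∑ z : Config n T Q, Qchi χ z * Real.log (Qchi χ z)

/-- The variational fixed-point equation (Lemma 2). -/
def VarFixedPointEq {n T Q : ℕ} (Γ : Fin Q → Fin Q → ℝ) (χ : VarParam n T Q) : Prop :=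
  ∀ q l : Fin Q, Γ q l =
    (∑ i : Fin n, ∑ t : Fin T, if (t : ℕ) + 1 < T then χ.η i t q l else 0) /
    (∑ i : Fin n, ∑ t : Fin T, if (t : ℕ) + 1 < T then χ.τ i t q else 0)

/-- Marginal likelihood `P_θ(X^{1:s})` of the first `s` graphs. -/
noncomputable def likUpTo {Q : ℕ} (n T : ℕ) (Γ : Fin Q → Fin Q → ℝ) (α : Fin Q → ℝ)
    (π : Fin T → Fin Q → Fin Q → ℝ) (s : ℕ) (x : Obs n T) : ℝ :=
  ∑ z : Config n T Q, latentP n T Γ α z *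
    ∏ t : Fin T, if (t : ℕ) < s then
      (∏ i : Fin n, ∏ j : Fin n,
        if i < j then bern (π t (z i t) (z j t)) (x t i j) else 1) else 1

/-- `P_θ(Z^t = zt | X^{1:t-1})`. -/
noncomputable def probZGivenPast {Q : ℕ} (n T : ℕ) (Γ : Fin Q → Fin Q → ℝ)
    (α : Fin Q → ℝ) (π : Fin T → Fin Q → Fin Q → ℝ) (t : Fin T)
    (zt : Fin n → Fin Q) (x : Obs n T) : ℝ :=
  (∑ z : Config n T Q, (if ∀ i, z i t = zt i then (1 : ℝ) else 0) *
      (latentP n T Γ α z *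
        ∏ t' : Fin T, if (t' : ℕ) < (t : ℕ) then
          (∏ i : Fin n, ∏ j : Fin n,
            if i < j then bern (π t' (z i t') (z j t')) (x t' i j) else 1) else 1)) /
    likUpTo n T Γ α π (t : ℕ) x

/-- `log P_θ(X^t | Z^t = zt)`. -/
noncomputable def condLogAt {Q : ℕ} (n T : ℕ) (π : Fin T → Fin Q → Fin Q → ℝ)
    (t : Fin T) (zt : Fin n → Fin Q) (x : Obs n T) : ℝ :=
  Real.log (∏ i : Fin n, ∏ j : Fin n,
    if i < j then bern (π t (zt i) (zt j)) (x t i j) else 1)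

/-- `N_q(z^t)`: number of nodes in class `q` at time `t`. -/
def Nq {n T Q : ℕ} (z : Config n T Q) (t : Fin T) (q : Fin Q) : ℕ :=
  (Finset.univ.filter fun i : Fin n => z i t = q).card

/-- The set `Ω_η`: configurations whose empirical class proportions are at least `α_q - η`
at every time step. -/
def OmegaEta {n T Q : ℕ} (α : Fin Q → ℝ) (η : ℝ) : Set (Config n T Q) :=
  {z | ∀ t q, α q - η ≤ (Nq z t q : ℝ) / n}

/-- Hamming distance between configurations. -/
def hamming {n T Q : ℕ} (z z' : Config n T Q) : ℕ :=
  ∑ t : Fin T, (Finset.univ.filter fun i : Fin n => z i t ≠ z' i t).card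

/-- The set `D_{n,T}(z^{1:T}, π)` of triples `(i, j, t)` with `i < j` on which the
connectivity parameter differs between `z` and `z*`. -/
def discSet {n T Q : ℕ} (π : Fin Q → Fin Q → ℝ) (z zstar : Config n T Q) :
    Set (Fin n × Fin n × Fin T) :=
  {p | p.1 < p.2.1 ∧
    π (z p.1 p.2.2) (z p.2.1 p.2.2) ≠ π (zstar p.1 p.2.2) (zstar p.2.1 p.2.2)}


lemma bern_pos {p : ℝ} (hp : 0 < p) (hp' : p < 1) (b : Bool) : 0 < bern p b := by
  unfold bern
  split_ifs <;> linarith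

/-- A stationary distribution of a transition matrix with positive entries is positive. -/
lemma IsStationary.pos {Q : ℕ} {Γ : Fin Q → Fin Q → ℝ} {α : Fin Q → ℝ}
    (h : IsStationary Γ α) (hΓ : ∀ q l, 0 < Γ q l) (l : Fin Q) : 0 < α l := by
  obtain ⟨h0, h1, h2⟩ := h
  obtain ⟨q, -, hq⟩ : ∃ q ∈ (univ : Finset (Fin Q)), 0 < α q :=
    (sum_pos_iff_of_nonneg fun q _ => h0 q).1 (h1 ▸ one_pos)
  rw [← h2 l]
  exact sum_pos' (fun q _ => mul_nonneg (h0 q) (hΓ q l).le)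
    ⟨q, mem_univ q, mul_pos hq (hΓ q l)⟩

lemma latentP_pos {Q n T : ℕ} {Γ : Fin Q → Fin Q → ℝ} {α : Fin Q → ℝ}
    (hΓ : ∀ q l, 0 < Γ q l) (hα : ∀ q, 0 < α q) (z : Config n T Q) :
    0 < latentP n T Γ α z := by
  unfold latentP
  refine prod_pos fun i _ => mul_pos ?_ (prod_pos fun t _ => ?_)
  · split_ifs
    exacts [hα _, one_pos]
  · split_ifs
    exacts [hΓ _ _, one_pos]

/-- The likelihood of a single graph given the classes of its nodes is positive. -/
lemma prod_bern_pos {Q n : ℕ} {π : Fin Q → Fin Q → ℝ}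
    (hπ : ∀ q l, 0 < π q l ∧ π q l < 1) (z : Fin n → Fin Q) (x : Fin n → Fin n → Bool) :
    0 < ∏ i : Fin n, ∏ j : Fin n, if i < j then bern (π (z i) (z j)) (x i j) else 1 := by
  refine prod_pos fun i _ => prod_pos fun j _ => ?_
  split_ifs
  exacts [bern_pos (hπ _ _).1 (hπ _ _).2 _, one_pos]

/-- Adding one time step multiplies a product over the past by the factor at that time. -/
lemma prod_ite_lt_succ {T : ℕ} (f : Fin T → ℝ) (t : Fin T) :
    (∏ s : Fin T, if (s : ℕ) < (t : ℕ) + 1 then f s else 1) =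
      (∏ s : Fin T, if (s : ℕ) < (t : ℕ) then f s else 1) * f t := by
  have h : f t = ∏ s : Fin T, if s = t then f s else 1 := by simp
  rw [h, ← prod_mul_distrib]
  refine prod_congr rfl fun s _ => ?_
  rcases lt_trichotomy s t with hs | rfl | hs
  · have : (s : ℕ) < t := hs
    simp [this, hs.ne, Nat.lt_succ_of_lt this]
  · simp
  · have : (t : ℕ) < s := hs
    simp [hs.ne', show ¬ (s : ℕ) < t + 1 by omega, show ¬ (s : ℕ) < t by omega]

lemma abs_log_div_sub_log_le {A B P G : ℝ} (hA : 0 < A) (hP : 0 < P) (hG : 0 < G)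
    (hPA : P ≤ A) (hlow : P * G ≤ B) (hup : B ≤ A * G) :
    |Real.log (B / A) - Real.log G| ≤ |Real.log (P / A)| := by
  have hB : 0 < B := (mul_pos hP hG).trans_le hlow
  have h1 := Real.log_le_log hP hPA
  have h2 := Real.log_le_log (mul_pos hP hG) hlow
  have h3 := Real.log_le_log hB hup
  rw [Real.log_mul hP.ne' hG.ne'] at h2
  rw [Real.log_mul hA.ne' hG.ne'] at h3
  rw [Real.log_div hB.ne' hA.ne', Real.log_div hP.ne' hA.ne', abs_of_nonpos (by linarith),
    abs_of_nonpos (by linarith)]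
  linarith

/-- The log of a weighted mean of `g` is within `|log p|` of the log of the maximum `G`
of `g`, where `p` is the normalized weight of a set of maximizers. -/
lemma abs_log_weighted_mean_sub_log_le {ι : Type*} [Fintype ι] (w g : ι → ℝ)
    (s : ι → Prop) [DecidablePred s] {G : ℝ} (hw : ∀ z, 0 < w z) (hG : 0 < G)
    (hg : ∀ z, 0 < g z) (hgG : ∀ z, g z ≤ G) (hs : ∀ z, s z → g z = G) (hne : ∃ z, s z) :
    |Real.log ((∑ z, w z * g z) / ∑ z, w z) - Real.log G| ≤
      |Real.log ((∑ z, (if s z then (1 : ℝ) else 0) * w z) / ∑ z, w z)| := by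
  obtain ⟨z₀, hz₀⟩ := hne
  apply abs_log_div_sub_log_le _ _ hG
  · refine sum_le_sum fun z _ => ?_
    split_ifs <;> linarith [hw z]
  · rw [sum_mul]
    refine sum_le_sum fun z _ => ?_
    split_ifs with h
    · simp [hs z h]
    · simpa using (mul_pos (hw z) (hg z)).le
  · rw [sum_mul]
    exact sum_le_sum fun z _ => mul_le_mul_of_nonneg_left (hgG z) (hw z).le
  · exact sum_pos (fun z _ => hw z) ⟨z₀, mem_univ _⟩
  · refine sum_pos' (fun z _ => ?_) ⟨z₀, mem_univ _, by simpa [hz₀] using hw z₀⟩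
    split_ifs <;> simp [(hw z).le]

/-- **Lemma ('lemmet1').** Fix `θ ∈ Θ` and for each `t` let `ẑ^t` be a maximizer of
`z ↦ log P_θ(X^t | Z^t = z)`. Then (for every realization of the data) for every `t`,
`|log P_θ(X^t | X^{1:t-1}) - log P_θ(X^t | Z^t = ẑ^t)| ≤ |log P_θ(Z^t = ẑ^t | X^{1:t-1})|`,
where for `t = 1` the conditioning on `X^{1:0}` is no conditioning. -/
theorem conditional_loglik_approximation
    (Q n T : ℕ) (hQ : 1 ≤ Q) (hn : 2 ≤ n) (hT : 2 ≤ T) (δ ζ : ℝ)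
    (hδ : 0 < δ) (hδQ : δ < 1 / Q) (hζ : 0 < ζ)
    (θ : Param Q) (hθ : memTheta δ ζ θ)
    (hstat : IsStationary θ.Γ (statDist θ.Γ))
    (zhat : Obs n T → Fin T → Fin n → Fin Q)
    (hzhat : ∀ (x : Obs n T) (t : Fin T) (z : Fin n → Fin Q),
      condLogAt n T (fun _ => θ.π) t z x ≤ condLogAt n T (fun _ => θ.π) t (zhat x t) x)
    (x : Obs n T) (t : Fin T) :
    |Real.log (likUpTo n T θ.Γ (statDist θ.Γ) (fun _ => θ.π) ((t : ℕ) + 1) x /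
        likUpTo n T θ.Γ (statDist θ.Γ) (fun _ => θ.π) (t : ℕ) x) -
      condLogAt n T (fun _ => θ.π) t (zhat x t) x| ≤
    |Real.log (probZGivenPast n T θ.Γ (statDist θ.Γ) (fun _ => θ.π) t (zhat x t) x)| := by
  obtain ⟨-, hΓ, -, hπ, -⟩ := hθ
  have hπ' : ∀ q l, 0 < θ.π q l ∧ θ.π q l < 1 := fun q l =>
    ⟨hζ.trans_le (hπ q l).1, by linarith [(hπ q l).2]⟩
  have hΓ' : ∀ q l, 0 < θ.Γ q l := fun q l => hδ.trans_le (hΓ q l).1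
  let f : Fin T → (Fin n → Fin Q) → ℝ := fun s y =>
    ∏ i : Fin n, ∏ j : Fin n, if i < j then bern (θ.π (y i) (y j)) (x s i j) else 1
  have hf : ∀ s y, 0 < f s y := fun s y => prod_bern_pos hπ' y (x s)
  let w : Config n T Q → ℝ := fun z => latentP n T θ.Γ (statDist θ.Γ) z *
    ∏ s : Fin T, if (s : ℕ) < (t : ℕ) then f s (fun i => z i s) else 1
  have hw : ∀ z, 0 < w z := fun z => by
    refine mul_pos (latentP_pos hΓ' (hstat.pos hΓ') z) (prod_pos fun s _ => ?_)
    split_ifs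
    exacts [hf _ _, one_pos]
  have hsucc : likUpTo n T θ.Γ (statDist θ.Γ) (fun _ => θ.π) ((t : ℕ) + 1) x =
      ∑ z, w z * f t (fun i => z i t) := by
    refine sum_congr rfl fun z _ => ?_
    rw [mul_assoc, ← prod_ite_lt_succ (fun s => f s (fun i => z i s)) t]
  rw [hsucc]
  refine abs_log_weighted_mean_sub_log_le w (fun z => f t (fun i => z i t))
    (fun z => ∀ i, z i t = zhat x t i) hw (hf t (zhat x t)) (fun z => hf _ _) (fun z => ?_)
    (fun z hz => ?_) ⟨fun i _ => zhat x t i, fun _ => rfl⟩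
  · exact (Real.log_le_log_iff (hf _ _) (hf _ _)).1 (hzhat x t fun i => z i t)
  · exact congrArg (f t) (funext hz)

end DynSBM
end

section
/- Separation of the limiting contrast function (Lemma 16 / 'lem:fct_M'). For any θ = (Γ, π) ∈ Θ and any ε with 0 < ε < (1/2) · min_{1≤q≠q'≤Q} max_{1≤l≤Q} |π*_{ql} − π*_{q'l}|: if min_{σ ∈ S_Q} ‖π_σ − π*‖_∞ > ε, then 𝕄(π*) − 𝕄(π) > (2δ²/Q²) ε². -/
open Finset Filter Asymptotics

namespace DynSBM

/-- Binary Pinsker inequality, in cross-entropy form. -/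
theorem cross_entropy_add_two_mul_sq_le {p x : ℝ} (hp : p ∈ Set.Ioo (0 : ℝ) 1)
    (hx : x ∈ Set.Ioo (0 : ℝ) 1) :
    p * Real.log x + (1 - p) * Real.log (1 - x) + 2 * (x - p) ^ 2 ≤
      p * Real.log p + (1 - p) * Real.log (1 - p) := by
  set g : ℝ → ℝ := fun y => p * Real.log y + (1 - p) * Real.log (1 - y) + 2 * (y - p) ^ 2
    with hg
  have hderiv : ∀ y ∈ Set.Ioo (0 : ℝ) 1,
      HasDerivAt g ((p - y) * ((1 - 2 * y) ^ 2 / (y * (1 - y)))) y := by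
    rintro y ⟨h0, h1⟩
    have h1' : 1 - y ≠ 0 := by linarith
    have hd := (((Real.hasDerivAt_log h0.ne').const_mul p).add
      ((((hasDerivAt_id y).const_sub 1).log h1').const_mul (1 - p))).add
      ((((hasDerivAt_id y).sub_const p).pow 2).const_mul 2)
    refine hd.congr_deriv ?_
    have h0' := h0.ne'
    simp only [id]
    field_simp
    ring
  have hpos : ∀ y ∈ Set.Ioo (0 : ℝ) 1, 0 ≤ (1 - 2 * y) ^ 2 / (y * (1 - y)) := fun y hy =>
    div_nonneg (sq_nonneg _) (mul_nonneg hy.1.le (by linarith [hy.2]))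
  suffices h : g x ≤ g p by simpa [hg] using h
  rcases le_total x p with hxp | hpx
  · have hsub : Set.Icc x p ⊆ Set.Ioo (0 : ℝ) 1 := Set.Icc_subset_Ioo hx.1 hp.2
    refine monotoneOn_of_hasDerivWithinAt_nonneg (convex_Icc x p)
      (fun y hy => (hderiv y (hsub hy)).continuousAt.continuousWithinAt)
      (fun y hy => (hderiv y (hsub (interior_subset hy))).hasDerivWithinAt)
      (fun y hy => mul_nonneg ?_ (hpos y (hsub (interior_subset hy))))
      (Set.left_mem_Icc.2 hxp) (Set.right_mem_Icc.2 hxp) hxp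
    linarith [(interior_subset hy : y ∈ Set.Icc x p).2]
  · have hsub : Set.Icc p x ⊆ Set.Ioo (0 : ℝ) 1 := Set.Icc_subset_Ioo hp.1 hx.2
    refine antitoneOn_of_hasDerivWithinAt_nonpos (convex_Icc p x)
      (fun y hy => (hderiv y (hsub hy)).continuousAt.continuousWithinAt)
      (fun y hy => (hderiv y (hsub (interior_subset hy))).hasDerivWithinAt)
      (fun y hy => mul_nonpos_of_nonpos_of_nonneg ?_ (hpos y (hsub (interior_subset hy))))
      (Set.left_mem_Icc.2 hpx) (Set.right_mem_Icc.2 hpx) hpx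
    linarith [(interior_subset hy : y ∈ Set.Icc p x).1]

theorem memTheta.mem_Ioo {Q : ℕ} {δ ζ : ℝ} {θ : Param Q} (hθ : memTheta δ ζ θ) (hζ : 0 < ζ)
    (q l : Fin Q) : θ.π q l ∈ Set.Ioo (0 : ℝ) 1 := by
  have h := hθ.2.2.2.1 q l
  exact ⟨hζ.trans_le h.1, h.2.trans_lt (by linarith)⟩

theorem IsStationary.le_of_forall_le {Q : ℕ} {Γ : Fin Q → Fin Q → ℝ} {α : Fin Q → ℝ} {δ : ℝ}
    (hα : IsStationary Γ α) (hΓ : ∀ q l, δ ≤ Γ q l) (l : Fin Q) : δ ≤ α l := by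
  obtain ⟨h0, h1, h2⟩ := hα
  calc δ = ∑ q, α q * δ := by rw [← Finset.sum_mul, h1, one_mul]
    _ ≤ ∑ q, α q * Γ q l :=
      Finset.sum_le_sum fun q _ => mul_le_mul_of_nonneg_left (hΓ q l) (h0 q)
    _ = α l := h2 l

theorem IsStochastic.sum_sum_mul {Q : ℕ} {A : Fin Q → Fin Q → ℝ} (hA : IsStochastic A)
    (q l : Fin Q) : ∑ q', ∑ l', A q q' * A l l' = 1 := by
  rw [← Finset.sum_mul_sum, hA.2, hA.2, one_mul]

theorem IsStochastic.exists_inv_le {Q : ℕ} {A : Fin Q → Fin Q → ℝ} (hA : IsStochastic A)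
    (q : Fin Q) : ∃ q', (Q : ℝ)⁻¹ ≤ A q q' := by
  have : Nonempty (Fin Q) := ⟨q⟩
  have hQ : (Q : ℝ) ≠ 0 := Nat.cast_ne_zero.2 (Fin.pos q).ne'
  obtain ⟨q', -, h⟩ := Finset.exists_le_of_sum_le (s := Finset.univ)
    (f := fun _ : Fin Q => (Q : ℝ)⁻¹) (g := A q) Finset.univ_nonempty (by simp [hA.2, hQ])
  exact ⟨q', h⟩

theorem isStochastic_one (Q : ℕ) :
    IsStochastic (fun q q' : Fin Q => if q = q' then (1 : ℝ) else 0) :=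
  ⟨fun q l => by positivity, fun q => by simp⟩

theorem Mcontrast_one {Q : ℕ} (α : Fin Q → ℝ) (πstar π : Fin Q → Fin Q → ℝ) :
    Mcontrast α πstar π (fun q q' => if q = q' then 1 else 0) =
      ∑ q, ∑ l, α q * α l *
        (πstar q l * Real.log (π q l) + (1 - πstar q l) * Real.log (1 - π q l)) := by
  simp [Mcontrast, mul_assoc]

/-- The excess contrast is bounded below by a weighted sum of squared deviations. -/
theorem Mcontrast_add_sum_sq_le {Q : ℕ} {α : Fin Q → ℝ} {πstar π A : Fin Q → Fin Q → ℝ}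
    (hα : ∀ q, 0 ≤ α q) (hπstar : ∀ q l, πstar q l ∈ Set.Ioo (0 : ℝ) 1)
    (hπ : ∀ q l, π q l ∈ Set.Ioo (0 : ℝ) 1) (hA : IsStochastic A) :
    Mcontrast α πstar π A + ∑ q, ∑ l, α q * α l * ∑ q', ∑ l', A q q' * A l l' *
        (2 * (π q' l' - πstar q l) ^ 2) ≤
      Mcontrast α πstar πstar (fun q q' => if q = q' then 1 else 0) := by
  rw [Mcontrast_one, Mcontrast]
  simp only [← Finset.sum_add_distrib, ← mul_add]
  refine Finset.sum_le_sum fun q _ => Finset.sum_le_sum fun l _ =>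
    mul_le_mul_of_nonneg_left ?_ (mul_nonneg (hα q) (hα l))
  refine (Finset.sum_le_sum fun q' _ => Finset.sum_le_sum fun l' _ =>
    mul_le_mul_of_nonneg_left (cross_entropy_add_two_mul_sq_le (hπstar q l) (hπ q' l'))
      (mul_nonneg (hA.1 q q') (hA.1 l l'))).trans_eq ?_
  simp only [← Finset.sum_mul]
  rw [hA.sum_sum_mul, one_mul]

theorem Mcontrast_one_le_Mlim {Q : ℕ} {α : Fin Q → ℝ} {π : Fin Q → Fin Q → ℝ}
    (hα : ∀ q, 0 ≤ α q) (hπ : ∀ q l, π q l ∈ Set.Ioo (0 : ℝ) 1) :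
    Mcontrast α π π (fun q q' => if q = q' then 1 else 0) ≤ Mlim α π π := by
  refine le_csSup ⟨Mcontrast α π π (fun q q' => if q = q' then 1 else 0), ?_⟩
    ⟨_, isStochastic_one Q, rfl⟩
  rintro _ ⟨A, hA, rfl⟩
  refine le_trans (le_add_of_nonneg_right ?_) (Mcontrast_add_sum_sq_le hα hπ hπ hA)
  exact Finset.sum_nonneg fun q _ => Finset.sum_nonneg fun l _ =>
    mul_nonneg (mul_nonneg (hα q) (hα l)) <| Finset.sum_nonneg fun q' _ =>
      Finset.sum_nonneg fun l' _ =>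
        mul_nonneg (mul_nonneg (hA.1 q q') (hA.1 l l')) (by positivity)

theorem exists_lt_abs_of_lt_dinf {Q : ℕ} {π π' : Fin Q → Fin Q → ℝ} {ε : ℝ} (hQ : 1 ≤ Q)
    (h : ε < dinf π π') : ∃ q l, ε < |π q l - π' q l| := by
  have : Nonempty (Fin Q) := ⟨⟨0, hQ⟩⟩
  obtain ⟨q, hq⟩ := exists_lt_of_lt_ciSup h
  obtain ⟨l, hl⟩ := exists_lt_of_lt_ciSup hq
  exact ⟨q, l, hl⟩

/-- If `π` is `ε`-far from every relabelling of `πstar`, and the rows of `πstar` are separated by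
more than `2 ε`, then `π` stays `ε`-far along every map of the classes, injective or not. -/
theorem exists_lt_abs_sub_of_lt_minPermDist {Q : ℕ} {π πstar : Fin Q → Fin Q → ℝ} {ε : ℝ}
    (hQ : 1 ≤ Q)
    (hsep : ∀ q q' : Fin Q, q ≠ q' → ε < (1 / 2) * ⨆ l, |πstar q l - πstar q' l|)
    (hfar : ε < minPermDist π πstar) (f : Fin Q → Fin Q) :
    ∃ q l, ε < |π (f q) (f l) - πstar q l| := by
  have : Nonempty (Fin Q) := ⟨⟨0, hQ⟩⟩
  by_cases hf : Function.Injective f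
  · have h := hfar.trans_le (ciInf_le (Set.finite_range _).bddBelow
      (Equiv.ofBijective f (Finite.injective_iff_bijective.1 hf)))
    exact exists_lt_abs_of_lt_dinf hQ h
  · simp only [Function.Injective, not_forall] at hf
    obtain ⟨q₁, q₂, heq, hne⟩ := hf
    have hlt : 2 * ε < ⨆ l, |πstar q₁ l - πstar q₂ l| := by linarith [hsep q₁ q₂ hne]
    obtain ⟨l, hl⟩ := exists_lt_of_lt_ciSup hlt
    by_contra! hcon
    have h₁ := hcon q₁ l
    have h₂ := hcon q₂ l
    rw [heq, abs_sub_comm] at h₁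
    linarith [abs_sub_le (πstar q₁ l) (π (f q₂) (f l)) (πstar q₂ l)]

/-- A uniform version of `exists_lt_abs_sub_of_lt_minPermDist`. -/
theorem exists_forall_exists_le_abs_sub {Q : ℕ} {π πstar : Fin Q → Fin Q → ℝ} {ε : ℝ}
    (hQ : 1 ≤ Q)
    (hsep : ∀ q q' : Fin Q, q ≠ q' → ε < (1 / 2) * ⨆ l, |πstar q l - πstar q' l|)
    (hfar : ε < minPermDist π πstar) :
    ∃ ε' > ε, ∀ f : Fin Q → Fin Q, ∃ q l, ε' ≤ |π (f q) (f l) - πstar q l| := by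
  choose q l hql using exists_lt_abs_sub_of_lt_minPermDist hQ hsep hfar
  have : Nonempty (Fin Q) := ⟨⟨0, hQ⟩⟩
  obtain ⟨f₀, hf₀⟩ := Finite.exists_min fun f : Fin Q → Fin Q =>
    |π (f (q f)) (f (l f)) - πstar (q f) (l f)|
  exact ⟨_, hql f₀, fun f => ⟨q f, l f, hf₀ f⟩⟩

/-- **Lemma ('lem:fct_M').** Separation of the limiting contrast function: for any
`θ = (Γ, π) ∈ Θ` and any `ε` with
`0 < ε < (1/2) min_{q ≠ q'} max_l |π*_{ql} - π*_{q'l}|`,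
if `min_{σ ∈ S_Q} ‖π_σ - π*‖_∞ > ε` then `𝕄(π*) - 𝕄(π) > (2δ²/Q²) ε²`. -/
theorem contrast_separation
    (Q : ℕ) (hQ : 1 ≤ Q) (δ ζ : ℝ) (hδ : 0 < δ) (hδQ : δ < 1 / Q) (hζ : 0 < ζ)
    (θstar : Param Q) (hθstar : memTheta δ ζ θstar)
    (αstar : Fin Q → ℝ) (hαstar : IsStationary θstar.Γ αstar)
    (θ : Param Q) (hθ : memTheta δ ζ θ)
    (ε : ℝ) (hε : 0 < ε)
    (hεsmall : ∀ q q' : Fin Q, q ≠ q' →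
      ε < (1 / 2) * ⨆ l, |θstar.π q l - θstar.π q' l|)
    (hfar : ε < minPermDist θ.π θstar.π) :
    2 * δ ^ 2 / (Q : ℝ) ^ 2 * ε ^ 2 <
      Mlim αstar θstar.π θstar.π - Mlim αstar θstar.π θ.π := by
  have hα0 := hαstar.1
  have hαδ := hαstar.le_of_forall_le fun q l => (hθstar.2.1 q l).1
  have hπstar := hθstar.mem_Ioo hζ
  have hπ := hθ.mem_Ioo hζ
  obtain ⟨ε', hε', hfar'⟩ := exists_forall_exists_le_abs_sub hQ hεsmall hfar
  have hQ0 : (0 : ℝ) < Q := by exact_mod_cast hQ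
  suffices h : Mlim αstar θstar.π θ.π ≤
      Mlim αstar θstar.π θstar.π - 2 * δ ^ 2 / (Q : ℝ) ^ 2 * ε' ^ 2 by
    have : 2 * δ ^ 2 / (Q : ℝ) ^ 2 * ε ^ 2 < 2 * δ ^ 2 / (Q : ℝ) ^ 2 * ε' ^ 2 := by gcongr
    linarith
  refine csSup_le ⟨_, _, isStochastic_one Q, rfl⟩ ?_
  rintro _ ⟨A, hA, rfl⟩
  choose f hf using hA.exists_inv_le
  obtain ⟨q, l, hql⟩ := hfar' f
  have hinner : ∀ q l q' l', 0 ≤ A q q' * A l l' * (2 * (θ.π q' l' - θstar.π q l) ^ 2) :=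
    fun q l q' l' => mul_nonneg (mul_nonneg (hA.1 q q') (hA.1 l l')) (by positivity)
  have houter : ∀ q l, 0 ≤ αstar q * αstar l * ∑ q', ∑ l', A q q' * A l l' *
      (2 * (θ.π q' l' - θstar.π q l) ^ 2) := fun q l =>
    mul_nonneg (mul_nonneg (hα0 q) (hα0 l)) <|
      Finset.sum_nonneg fun q' _ => Finset.sum_nonneg fun l' _ => hinner q l q' l'
  have hsq : ε' ^ 2 ≤ (θ.π (f q) (f l) - θstar.π q l) ^ 2 := by
    rw [← sq_abs (θ.π (f q) (f l) - θstar.π q l)]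
    exact pow_le_pow_left₀ (hε.trans hε').le hql 2
  have hlow : 2 * δ ^ 2 / (Q : ℝ) ^ 2 * ε' ^ 2 ≤
      ∑ q, ∑ l, αstar q * αstar l * ∑ q', ∑ l', A q q' * A l l' *
        (2 * (θ.π q' l' - θstar.π q l) ^ 2) := by
    calc 2 * δ ^ 2 / (Q : ℝ) ^ 2 * ε' ^ 2
        = δ * δ * ((Q : ℝ)⁻¹ * (Q : ℝ)⁻¹ * (2 * ε' ^ 2)) := by field_simp
      _ ≤ αstar q * αstar l * (A q (f q) * A l (f l) *
            (2 * (θ.π (f q) (f l) - θstar.π q l) ^ 2)) := by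
          have hαα := mul_nonneg (hα0 q) (hα0 l)
          have hAA := mul_nonneg (hA.1 q (f q)) (hA.1 l (f l))
          have := hα0 q
          have := hA.1 q (f q)
          gcongr
          exacts [hαδ q, hαδ l, hf q, hf l]
      _ ≤ αstar q * αstar l * ∑ q', ∑ l', A q q' * A l l' *
            (2 * (θ.π q' l' - θstar.π q l) ^ 2) := by
          refine mul_le_mul_of_nonneg_left ?_ (mul_nonneg (hα0 q) (hα0 l))
          exact (Finset.single_le_sum (fun l' _ => hinner q l (f q) l')
            (Finset.mem_univ (f l))).trans
            (Finset.single_le_sum (f := fun q' => ∑ l', A q q' * A l l' *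
              (2 * (θ.π q' l' - θstar.π q l) ^ 2))
              (fun q' _ => Finset.sum_nonneg fun l' _ => hinner q l q' l')
              (Finset.mem_univ (f q)))
      _ ≤ _ := (Finset.single_le_sum (fun l _ => houter q l) (Finset.mem_univ l)).trans
            (Finset.single_le_sum (f := fun q => ∑ l, αstar q * αstar l *
              ∑ q', ∑ l', A q q' * A l l' * (2 * (θ.π q' l' - θstar.π q l) ^ 2))
              (fun q _ => Finset.sum_nonneg fun l _ => houter q l) (Finset.mem_univ q))
  linarith [Mcontrast_add_sum_sq_le hα0 hπstar hπ hA, Mcontrast_one_le_Mlim hα0 hπstar]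

end DynSBM
end
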